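/- arXiv:1304.6544 — 2 statements merged into one kernel-verified Lean document; each statement's English description precedes it below -/
import Mathlib

section
/- For every real number z with 0 < z < 4/27, one has Σ_{n≥0} C(3n,n)·(2/(n+1)) · zⁿ = (2 − 2·F(27z/4))/(3z), where F(u) = Σ_{n≥0} [(−2/3)ₙ (−1/3)ₙ / ((−1/2)ₙ n!)] · uⁿ. -/
/-- The rising Pochhammer symbol `(a)ₙ = a(a+1)⋯(a+n−1)`. -/
noncomputable def poch (a : ℝ) (n : ℕ) : ℝ := ∏ i ∈ Finset.range n, (a + i)

/-- The Gauss hypergeometric series `₂F₁(−2/3, −1/3; −1/2 | u)`. -/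
noncomputable def F (u : ℝ) : ℝ :=
  ∑' n : ℕ, poch (-2 / 3) n * poch (-1 / 3) n / (poch (-1 / 2) n * n.factorial) * u ^ n

lemma ch_rec (n : ℕ) : ((3 * (n+1)).choose (n+1) : ℝ) * (2 * (n+1) * (2*n+1))
    = 3 * (3*n+1) * (3*n+2) * ((3*n).choose n : ℝ) := by
  have h1 := Nat.choose_mul_factorial_mul_factorial (n := 3*n) (k := n) (by omega)
  have h2 := Nat.choose_mul_factorial_mul_factorial (n := 3*(n+1)) (k := n+1) (by omega)
  rw [show 3*n - n = 2*n by omega] at h1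
  rw [show 3*(n+1) - (n+1) = 2*n+1+1 by omega, show (3*(n+1)).factorial = (3*n+1+1+1).factorial by rfl] at h2
  simp only [Nat.factorial_succ] at h2
  have h1' : ((3*n).choose n : ℝ) * n.factorial * (2*n).factorial = (3*n).factorial := by
    exact_mod_cast h1
  have h2' := congrArg (Nat.cast (R := ℝ)) h2
  push_cast at h2'
  have p1 : (n.factorial : ℝ) ≠ 0 := by positivity
  have p2 : ((2*n).factorial : ℝ) ≠ 0 := by positivity
  have p3 : (n:ℝ) + 1 ≠ 0 := by positivity
  rw [← h1'] at h2'
  apply mul_left_cancel₀ (mul_ne_zero (mul_ne_zero p1 p2) p3)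
  linear_combination h2'

lemma ch_bd (n : ℕ) : ((3 * n).choose n : ℝ) ≤ (27/4)^n := by
  induction n with
  | zero => simp
  | succ n ih =>
    have h := ch_rec n
    have hp : (0:ℝ) < 2 * (n+1) * (2*n+1) := by positivity
    rw [← mul_le_mul_iff_left₀ hp, h, pow_succ]
    calc 3 * (3*(n:ℝ)+1) * (3*n+2) * ((3*n).choose n : ℝ)
        ≤ 3 * (3*(n:ℝ)+1) * (3*n+2) * (27/4)^n := by gcongr
      _ ≤ (27/4 * (2 * (n+1) * (2*n+1))) * (27/4)^n := by
        apply mul_le_mul_of_nonneg_right _ (by positivity)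
        nlinarith [(Nat.cast_nonneg n : (0:ℝ) ≤ n)]
      _ = _ := by ring

lemma poch_half_ne (n : ℕ) : poch (-1/2) n ≠ 0 := by
  unfold poch
  rw [Finset.prod_ne_zero_iff]
  intro i _ h
  have : (2 * i : ℝ) = 1 := by linarith
  have : 2 * i = 1 := by exact_mod_cast this
  omega

lemma coef (n : ℕ) : poch (-2 / 3) (n+1) * poch (-1 / 3) (n+1) / (poch (-1 / 2) (n+1) * (n+1).factorial) * (27/4)^(n+1) = -3/(n+1) * ((3*n).choose n : ℝ) := by
  induction n with
  | zero => simp [poch]; norm_num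
  | succ n ih =>
    have h := ch_rec n
    have s : ∀ a, poch a (n+1+1) = poch a (n+1) * (a + (n+1)) := by
      intro a; simp [poch, Finset.prod_range_succ]
    have q := poch_half_ne (n+1)
    have p1 : ((n+1).factorial : ℝ) ≠ 0 := by positivity
    have hc : ((3 * (n+1)).choose (n+1) : ℝ) = 3 * (3*n+1) * (3*n+2) * ((3*n).choose n : ℝ) / (2 * (n+1) * (2*n+1)) := by
      rw [← h]; field_simp
    have e3 : (-1/2 + ((n:ℝ)+1)) ≠ 0 := by
      have : (0:ℝ) < -1/2 + ((n:ℝ)+1) := by linarith [(Nat.cast_nonneg n : (0:ℝ) ≤ n)]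
      exact this.ne'
    rw [s, s, s, Nat.factorial_succ (n+1), pow_succ, hc]
    push_cast
    have e4 : (n:ℝ)+1+1 ≠ 0 := by positivity
    calc _ = (poch (-2 / 3) (n+1) * poch (-1 / 3) (n+1) / (poch (-1 / 2) (n+1) * (n+1).factorial) * (27/4)^(n+1)) * ((-2/3 + ((n:ℝ)+1)) * (-1/3+((n:ℝ)+1)) / ((-1/2 + ((n:ℝ)+1)) * ((n:ℝ)+1+1)) * (27/4)) := by
          field_simp
      _ = _ := by
          rw [ih, show (-1/2 + ((n:ℝ)+1)) = (2*n+1)/2 by ring]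
          field_simp
          ring

theorem stmt_7 (z : ℝ) (hz0 : 0 < z) (hz1 : z < 4 / 27) :
    ∑' n : ℕ, (Nat.choose (3 * n) n : ℝ) * (2 / (n + 1)) * z ^ n
      = (2 - 2 * F (27 * z / 4)) / (3 * z) := by
  have hs : Summable fun n : ℕ => (Nat.choose (3 * n) n : ℝ) * (2 / (n + 1)) * z ^ n := by
    have hg : Summable fun n : ℕ => 2 * (27/4*z)^n :=
      (summable_geometric_of_lt_one (by positivity) (by linarith)).mul_left 2
    refine hg.of_nonneg_of_le (fun n => by positivity) (fun n => ?_)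
    have : (2:ℝ) / (n+1) ≤ 2 := div_le_self (by norm_num) (by simp)
    calc _ ≤ (27/4:ℝ)^n * 2 * z^n := by
          gcongr
          exact ch_bd n
      _ = _ := by rw [mul_pow]; ring
  have key : ∀ n : ℕ, poch (-2 / 3) (n+1) * poch (-1 / 3) (n+1) / (poch (-1 / 2) (n+1) * (n+1).factorial) * (27*z/4)^(n+1) = (-3/2*z) * ((Nat.choose (3 * n) n : ℝ) * (2 / (n + 1)) * z ^ n) := by
    intro n
    rw [show 27*z/4 = 27/4*z by ring, mul_pow, ← mul_assoc, coef]
    ring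
  have hF : F (27*z/4) = 1 + (-3/2*z) * ∑' n : ℕ, (Nat.choose (3 * n) n : ℝ) * (2 / (n + 1)) * z ^ n := by
    unfold F
    rw [Summable.tsum_eq_zero_add]
    · simp_rw [key]
      rw [tsum_mul_left]
      simp [poch]
    · rw [← summable_nat_add_iff 1]
      simp_rw [key]
      exact hs.mul_left _
  rw [hF]
  generalize (∑' n : ℕ, (Nat.choose (3 * n) n : ℝ) * (2 / (n + 1)) * z ^ n) = S
  field_simp
  ring
end

section
/- Define, for x ∈ (0, 27/4), V(x) = (√3/(2^{10/3}·π·x^{2/3}))·(3√(1−4x/27) − 1)·(1+√(1−4x/27))^{1/3} + (1/(2^{8/3}·π·x^{1/3}·√3))·(3√(1−4x/27) + 1)·(1+√(1−4x/27))^{−1/3}. Then for every natural number n, ∫₀^{27/4} xⁿ · V(x) dx = C(3n,n)/(n+1). -/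
open Real

/-- The density of the measure `μ₀` whose moments are `C(3n,n)/(n+1)`. -/
noncomputable def V (x : ℝ) : ℝ :=
  Real.sqrt 3 / ((2 : ℝ) ^ ((10 : ℝ) / 3) * Real.pi * x ^ ((2 : ℝ) / 3)) *
      (3 * Real.sqrt (1 - 4 * x / 27) - 1) *
      (1 + Real.sqrt (1 - 4 * x / 27)) ^ ((1 : ℝ) / 3)
    + 1 / ((2 : ℝ) ^ ((8 : ℝ) / 3) * Real.pi * x ^ ((1 : ℝ) / 3) * Real.sqrt 3) *
      (3 * Real.sqrt (1 - 4 * x / 27) + 1) *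
      (1 + Real.sqrt (1 - 4 * x / 27)) ^ (-(1 : ℝ) / 3)

lemma aux_beta (u v : ℝ) (hu : 0 < u) (hv : 0 < v) :
    IntervalIntegrable (fun t : ℝ => t ^ (u - 1) * (1 - t) ^ (v - 1)) MeasureTheory.volume 0 1 ∧
    ∫ t in (0:ℝ)..1, t ^ (u - 1) * (1 - t) ^ (v - 1)
      = Real.Gamma u * Real.Gamma v / Real.Gamma (u + v) := by
  have hc := Complex.betaIntegral_convergent (u := (u:ℂ)) (v := (v:ℂ)) (by simpa) (by simpa)
  have heq : ∀ t ∈ Set.Ioc (0:ℝ) 1, ((t:ℂ) ^ ((u:ℂ) - 1) * (1 - (t:ℂ)) ^ ((v:ℂ) - 1))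
      = ((t ^ (u - 1) * (1 - t) ^ (v - 1) : ℝ) : ℂ) := by
    intro t ht
    rw [Complex.ofReal_mul, Complex.ofReal_cpow ht.1.le, Complex.ofReal_cpow (by linarith [ht.2])]
    push_cast
    rfl
  constructor
  · rw [intervalIntegrable_iff, Set.uIoc_of_le zero_le_one] at hc ⊢
    have h2 : MeasureTheory.IntegrableOn
        (fun t : ℝ => ((t:ℂ) ^ ((u:ℂ) - 1) * (1 - (t:ℂ)) ^ ((v:ℂ) - 1)).re) (Set.Ioc 0 1)
        MeasureTheory.volume := MeasureTheory.Integrable.re hc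
    refine h2.congr_fun ?_ measurableSet_Ioc
    intro t ht
    simp only [heq t ht, Complex.ofReal_re]
  · have h := Complex.Gamma_mul_Gamma_eq_betaIntegral (s := (u:ℂ)) (t := (v:ℂ)) (by simpa) (by simpa)
    have hb : Complex.betaIntegral u v
        = ((∫ t in (0:ℝ)..1, t ^ (u - 1) * (1 - t) ^ (v - 1) : ℝ) : ℂ) := by
      rw [Complex.betaIntegral, ← intervalIntegral.integral_ofReal,
        intervalIntegral.integral_of_le zero_le_one, intervalIntegral.integral_of_le zero_le_one]
      exact MeasureTheory.setIntegral_congr_fun measurableSet_Ioc heq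
    rw [hb, ← Complex.ofReal_add, Complex.Gamma_ofReal, Complex.Gamma_ofReal,
      Complex.Gamma_ofReal] at h
    have h' : Real.Gamma u * Real.Gamma v = Real.Gamma (u + v) *
        ∫ t in (0:ℝ)..1, t ^ (u - 1) * (1 - t) ^ (v - 1) := by exact_mod_cast h
    have := Real.Gamma_pos_of_pos (add_pos hu hv)
    rw [h']
    field_simp

lemma aux_gamma (n : ℕ) : Real.Gamma (n + 2/3) * Real.Gamma (n + 1/3)
    = 2 * π / √3 * (3 * n).factorial / (27 ^ n * n.factorial) := by
  induction n with
  | zero =>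
    have h := Real.Gamma_mul_Gamma_one_sub (1/3)
    have h2 : π * (1/3) = π / 3 := by ring
    rw [h2, Real.sin_pi_div_three] at h
    norm_num at h ⊢
    rw [mul_comm, h]
    field_simp
  | succ k ih =>
    have e1 : ((k+1:ℕ):ℝ) + 2/3 = (k + 2/3) + 1 := by push_cast; ring
    have e2 : ((k+1:ℕ):ℝ) + 1/3 = (k + 1/3) + 1 := by push_cast; ring
    rw [e1, e2, Real.Gamma_add_one (by positivity), Real.Gamma_add_one (by positivity)]
    have e3 : 3 * (k+1) = 3*k+1+1+1 := by ring
    rw [e3]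
    simp only [Nat.factorial_succ]
    have : ((k:ℝ) + 2/3) * Gamma (k + 2/3) * ((k + 1/3) * Gamma (k + 1/3))
      = (k+2/3) * (k+1/3) * (Gamma (k + 2/3) * Gamma (k + 1/3)) := by ring
    rw [this, ih]
    have := Nat.factorial_pos k
    push_cast
    field_simp
    ring

/-- The transformed integrand. -/
noncomputable def gg (n : ℕ) (t : ℝ) : ℝ :=
  3 * √3 / (8 * π) * 27 ^ n *
    (12 * (t ^ (((n:ℝ) + 8/3) - 1) * (1 - t) ^ (((n:ℝ) + 1/3) - 1))
    - 14 * (t ^ (((n:ℝ) + 5/3) - 1) * (1 - t) ^ (((n:ℝ) + 1/3) - 1))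
    + 4 * (t ^ (((n:ℝ) + 2/3) - 1) * (1 - t) ^ (((n:ℝ) + 1/3) - 1)))

lemma gg_int (n : ℕ) : IntervalIntegrable (gg n) MeasureTheory.volume 0 1 := by
  have h (c : ℝ) (hc : 0 < c) := (aux_beta (n + c) (n + 1/3) (by positivity) (by positivity)).1
  exact ((((h (8/3) (by norm_num)).const_mul 12).sub
    ((h (5/3) (by norm_num)).const_mul 14)).add ((h (2/3) (by norm_num)).const_mul 4)).const_mul _

lemma gg_val (n : ℕ) : ∫ t in (0:ℝ)..1, gg n t = (Nat.choose (3 * n) n : ℝ) / (n + 1) := by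
  have h (c : ℝ) (hc : 0 < c) := (aux_beta (n + c) (n + 1/3) (by positivity) (by positivity))
  have h8 := h (8/3) (by norm_num)
  have h5 := h (5/3) (by norm_num)
  have h2 := h (2/3) (by norm_num)
  unfold gg
  rw [intervalIntegral.integral_const_mul, intervalIntegral.integral_add
    ((h8.1.const_mul 12).sub (h5.1.const_mul 14)) (h2.1.const_mul 4),
    intervalIntegral.integral_sub (h8.1.const_mul 12) (h5.1.const_mul 14),
    intervalIntegral.integral_const_mul, intervalIntegral.integral_const_mul,
    intervalIntegral.integral_const_mul, h8.2, h5.2, h2.2]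
  have e1 : (n:ℝ) + 5/3 = (n + 2/3) + 1 := by ring
  have e2 : (n:ℝ) + 8/3 = (n + 2/3) + 1 + 1 := by ring
  have e3 : (n:ℝ) + 2/3 + (n + 1/3) = ((2*n : ℕ):ℝ) + 1 := by push_cast; ring
  have e4 : (n:ℝ) + 2/3 + 1 + (n + 1/3) = ((2*n+1 : ℕ):ℝ) + 1 := by push_cast; ring
  have e5 : (n:ℝ) + 2/3 + 1 + 1 + (n + 1/3) = ((2*n+2 : ℕ):ℝ) + 1 := by push_cast; ring
  rw [e2, e1, e3, e4, e5, Real.Gamma_nat_eq_factorial, Real.Gamma_nat_eq_factorial,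
    Real.Gamma_nat_eq_factorial, Real.Gamma_add_one (s := (n:ℝ) + 2/3 + 1) (by positivity),
    Real.Gamma_add_one (by positivity)]
  have hG := aux_gamma n
  have hch : (Nat.choose (3 * n) n : ℝ) = (3*n).factorial / (n.factorial * (2*n).factorial) := by
    rw [Nat.cast_choose ℝ (by omega : n ≤ 3 * n)]
    congr 4
    omega
  rw [hch]
  simp only [Nat.factorial_succ]
  set G := Gamma ((n:ℝ) + 2/3)
  set H := Gamma ((n:ℝ) + 1/3)
  have f1 : ((2*n).factorial : ℝ) ≠ 0 := by positivity
  have f2 : (n.factorial : ℝ) ≠ 0 := by positivity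
  have key : ∀ a : ℝ, a ≠ 0 → (12 * (((n:ℝ) + 2/3 + 1) * ((n + 2/3) * G) * H / ((2*n+1+1) * ((2*n+1)*a)))
     - 14 * ((n+2/3) * G * H / ((2*n+1)*a)) + 4 * (G * H / a)) = (G * H) / a * (4 / (3 * (n+1))) := by
    intro a ha
    have : (2*(n:ℝ)+1+1) ≠ 0 := by positivity
    field_simp
    ring
  push_cast
  rw [key _ f1, hG]
  have : √3 ≠ 0 := by positivity
  field_simp
  ring

lemma aux_pow (n : ℕ) (t : ℝ) (ht : 0 < t) (c : ℝ) (m : ℤ) (hc : c = m / 3) :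
    t ^ ((n:ℝ) + c) = t ^ n * (t ^ ((1:ℝ)/3)) ^ m := by
  rw [Real.rpow_add ht, Real.rpow_natCast, ← Real.rpow_intCast, ← Real.rpow_mul ht.le, hc]
  congr 2
  ring

lemma gg_eq (n : ℕ) (t : ℝ) (h0 : 0 < t) (h1 : t < 1) :
    gg n t = 3 * √3 / (8 * π) * 27 ^ n * (t ^ n * (1 - t) ^ n) *
      ((6 * t - 4) * (2 * t - 1)) / (t ^ ((1:ℝ)/3) * ((1 - t) ^ ((1:ℝ)/3)) ^ 2) := by
  have h2 : 0 < 1 - t := by linarith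
  have ha : 0 < t ^ ((1:ℝ)/3) := by positivity
  have hb : 0 < (1 - t) ^ ((1:ℝ)/3) := by positivity
  have ha3 : (t ^ ((1:ℝ)/3)) ^ 3 = t := by
    rw [← Real.rpow_natCast, ← Real.rpow_mul h0.le]; norm_num
  unfold gg
  rw [add_sub_assoc, add_sub_assoc, add_sub_assoc, add_sub_assoc,
    aux_pow n t h0 (8/3-1) 5 (by norm_num), aux_pow n t h0 (5/3-1) 2 (by norm_num),
    aux_pow n t h0 (2/3-1) (-1) (by norm_num), aux_pow n (1-t) h2 (1/3-1) (-2) (by norm_num)]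
  set a := t ^ ((1:ℝ)/3)
  set b := (1 - t) ^ ((1:ℝ)/3)
  have z1 : a ^ (5:ℤ) = t ^ 2 / a := by
    rw [← ha3]; field_simp
  have z2 : a ^ (2:ℤ) = t / a := by
    rw [eq_div_iff ha.ne']; rw [← ha3]; norm_cast
  have z3 : a ^ (-1:ℤ) = 1 / a := by simp
  have z4 : b ^ (-2:ℤ) = 1 / b ^ 2 := by rw [zpow_neg, one_div]; norm_cast
  rw [z1, z2, z3, z4]
  field_simp
  ring

lemma V_eq (n : ℕ) (t : ℝ) (h0 : 1/2 < t) (h1 : t < 1) :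
    |27 * (1 - 2 * t)| • ((27 * (t * (1 - t))) ^ n * V (27 * (t * (1 - t))))
      = gg n t + gg n (1 - t) := by
  have h2 : 0 < 1 - t := by linarith
  have ht : 0 < t := by linarith
  rw [gg_eq n t ht h1, gg_eq n (1-t) h2 (by linarith), sub_sub_cancel, abs_of_neg (by linarith),
    smul_eq_mul]
  have hs : √(1 - 4 * (27 * (t * (1 - t))) / 27) = 2 * t - 1 := by
    rw [show 1 - 4 * (27 * (t * (1 - t))) / 27 = (2 * t - 1) ^ 2 by ring]
    exact Real.sqrt_sq (by linarith)
  unfold V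
  rw [hs]
  have e27 : (27:ℝ) ^ ((1:ℝ)/3) = 3 := by
    rw [show (27:ℝ) = 3 ^ (3:ℝ) by norm_num, ← Real.rpow_mul (by norm_num)]; norm_num
  have hsq (x : ℝ) (hx : 0 < x) : x ^ ((2:ℝ)/3) = (x ^ ((1:ℝ)/3)) ^ 2 := by
    rw [← Real.rpow_natCast, ← Real.rpow_mul hx.le]; norm_num
  have hx : (27 * (t * (1 - t))) ^ ((1:ℝ)/3) = 3 * (t ^ ((1:ℝ)/3) * (1 - t) ^ ((1:ℝ)/3)) := by
    rw [Real.mul_rpow (by norm_num) (by positivity), Real.mul_rpow ht.le h2.le, e27]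
  have h2t : (1 + (2 * t - 1)) ^ ((1:ℝ)/3) = 2 ^ ((1:ℝ)/3) * t ^ ((1:ℝ)/3) := by
    rw [show 1 + (2 * t - 1) = 2 * t by ring, Real.mul_rpow (by norm_num) ht.le]
  have h2t' : (1 + (2 * t - 1)) ^ (-(1:ℝ)/3) = 1 / (2 ^ ((1:ℝ)/3) * t ^ ((1:ℝ)/3)) := by
    rw [neg_div, Real.rpow_neg (by linarith), h2t]; exact (one_div _).symm
  have c10 : (2:ℝ) ^ ((10:ℝ)/3) = 8 * 2 ^ ((1:ℝ)/3) := by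
    rw [show (10:ℝ)/3 = (3:ℕ) + 1/3 by norm_num, Real.rpow_add (by norm_num), Real.rpow_natCast]
    norm_num
  have c8 : (2:ℝ) ^ ((8:ℝ)/3) = 8 / 2 ^ ((1:ℝ)/3) := by
    rw [show (8:ℝ)/3 = (3:ℕ) - 1/3 by norm_num, Real.rpow_sub (by norm_num), Real.rpow_natCast]
    norm_num
  rw [hsq _ (by positivity), hx, h2t, h2t', c10, c8, mul_pow, mul_pow]
  have ha : 0 < t ^ ((1:ℝ)/3) := by positivity
  have hb : 0 < (1 - t) ^ ((1:ℝ)/3) := by positivity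
  have hc : 0 < (2:ℝ) ^ ((1:ℝ)/3) := by positivity
  set a := t ^ ((1:ℝ)/3)
  set b := (1 - t) ^ ((1:ℝ)/3)
  set c := (2:ℝ) ^ ((1:ℝ)/3)
  have h3 : √3 ^ 2 = 3 := Real.sq_sqrt (by norm_num)
  have h3p : 0 < √3 := by positivity
  set r := √3
  have hr : 1 / (8 / c * π * (3 * (a * b)) * r) = r * c / (72 * π * (a * b)) := by
    field_simp
    rw [h3]; norm_num
  rw [hr]
  generalize t ^ n = A
  generalize (1 - t) ^ n = B
  field_simp
  ring

theorem stmt_10 (n : ℕ) :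
    ∫ x in Set.Ioo (0 : ℝ) (27 / 4), x ^ n * V x
      = (Nat.choose (3 * n) n : ℝ) / (n + 1) := by
  have himg : (fun t : ℝ => 27 * (t * (1 - t))) '' Set.Ioo (1/2) 1 = Set.Ioo 0 (27/4) := by
    ext x
    simp only [Set.mem_image, Set.mem_Ioo]
    constructor
    · rintro ⟨t, ⟨h0, h1⟩, rfl⟩
      constructor
      · have : 0 < 1 - t := by linarith
        positivity
      · nlinarith [mul_pos (sub_pos.2 h0) (sub_pos.2 h0)]
    · rintro ⟨h0, h1⟩
      have hp : 0 < 1 - 4 * x / 27 := by linarith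
      have hs := Real.sq_sqrt hp.le
      have hs0 := Real.sqrt_pos.2 hp
      refine ⟨(1 + √(1 - 4 * x / 27)) / 2, ⟨by linarith, ?_⟩, by nlinarith⟩
      have : √(1 - 4 * x / 27) < 1 := by nlinarith
      linarith
  rw [← himg, MeasureTheory.integral_image_eq_integral_abs_deriv_smul
    (f' := fun t => 27 * (1 - 2 * t)) measurableSet_Ioo]
  rotate_left
  · intro t _
    have := (((hasDerivAt_id t).mul ((hasDerivAt_id t).const_sub 1)).const_mul 27)
    refine (HasDerivAt.congr_deriv this ?_).hasDerivWithinAt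
    simp; ring
  · intro s hs t ht hst
    simp only [Set.mem_Ioo] at hs ht
    have h : (s - t) * (1 - s - t) = 0 := by
      simp only at hst; linarith
    rcases mul_eq_zero.1 h with h | h <;> linarith
  rw [MeasureTheory.setIntegral_congr_fun measurableSet_Ioo
    (fun t ht => V_eq n t ht.1 ht.2), ← MeasureTheory.integral_Ioc_eq_integral_Ioo,
    ← intervalIntegral.integral_of_le (by norm_num)]
  have hL : IntervalIntegrable (gg n) MeasureTheory.volume 0 (1/2) :=
    (gg_int n).mono_set (by
      rw [Set.uIcc_of_le (by norm_num), Set.uIcc_of_le (by norm_num)]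
      exact Set.Icc_subset_Icc le_rfl (by norm_num))
  have hR : IntervalIntegrable (gg n) MeasureTheory.volume (1/2) 1 :=
    (gg_int n).mono_set (by
      rw [Set.uIcc_of_le (by norm_num), Set.uIcc_of_le (by norm_num)]
      exact Set.Icc_subset_Icc (by norm_num) le_rfl)
  have hL' : IntervalIntegrable (fun t => gg n (1 - t)) MeasureTheory.volume (1/2) 1 := by
    have := (hL.comp_sub_left 1).symm
    norm_num at this ⊢
    exact this
  rw [intervalIntegral.integral_add hR hL', intervalIntegral.integral_comp_sub_left (gg n) 1]
  rw [← gg_val n, ← intervalIntegral.integral_add_adjacent_intervals hL hR, add_comm]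
  norm_num
end
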